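/- At most two infinite clusters bound via trifurcations: Let G be a 2-regular graph on ℤ whose infinite components are disjoint bi-infinite paths, embedded in the plane with edges as non-crossing arcs in the upper and lower half-planes. Then for any N, the number of trifurcation points in ⟦1,N⟧ is at most 2 plus the number of infinite components meeting ⟦1,N⟧, where a trifurcation point is a vertex x such that the component of x, the first infinite component straddling above x, and the first infinite component straddling below x are all infinite, pairwise distinct, within distance 3 of x, and the configuration at x is (+1,+1) or (−1,−1). -/

import Mathlib

/-- `Matched ε x y`: in the sequence of parentheses `ε : ℤ → {±1}` (`+1` = opening,
`-1` = closing), the opening parenthesis at `x` is paired with the closing one at `y`: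
`x < y`, the word between them is balanced, and no prefix closes earlier. -/
def Matched (ε : ℤ → ℤ) (x y : ℤ) : Prop :=
  x < y ∧ ε x = 1 ∧ ε y = -1 ∧
    (∀ z, x ≤ z → z < y → 0 < ∑ i ∈ Finset.Icc x z, ε i) ∧
    (∑ i ∈ Finset.Icc x y, ε i) = 0

/-- Unordered version of `Matched`: `x` and `y` form an arc of the planar matching. -/
def MatchedSym (ε : ℤ → ℤ) (x y : ℤ) : Prop :=
  Matched ε x y ∨ Matched ε y x

/-- The graph `G` on `ℤ` obtained by superposing the upper matching (first coordinates
of `ω`) and the lower matching (second coordinates of `ω`). -/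
def matchingGraph (ω : ℤ → ℤ × ℤ) : SimpleGraph ℤ :=
  SimpleGraph.fromRel (fun a b =>
    Matched (fun z => (ω z).1) a b ∨ Matched (fun z => (ω z).2) a b)

/-- The cluster of `x` in `G`. -/
def cluster (ω : ℤ → ℤ × ℤ) (x : ℤ) : (matchingGraph ω).ConnectedComponent :=
  (matchingGraph ω).connectedComponentMk x

/-- The candidates for the first infinite cluster straddling above `x`: points `y > x`
matched in the upper half-plane to some `z < x` and whose cluster is infinite. -/
def straddleAbove (ω : ℤ → ℤ × ℤ) (x : ℤ) : Set ℤ :=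
  {y : ℤ | x < y ∧ ∃ z < x, MatchedSym (fun u => (ω u).1) z y ∧
    (cluster ω y).supp.Infinite}

/-- Same, below `x`, using the lower matching. -/
def straddleBelow (ω : ℤ → ℤ × ℤ) (x : ℤ) : Set ℤ :=
  {y : ℤ | x < y ∧ ∃ z < x, MatchedSym (fun u => (ω u).2) z y ∧
    (cluster ω y).supp.Infinite}

/-- Trifurcation points: the configuration at `x` is `(+1,+1)` or `(-1,-1)`, the
cluster of `x`, the first infinite cluster `C⁺(x)` straddling above `x` (cluster of the
least element of `straddleAbove`), and the first infinite cluster `C⁻(x)` below are all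
infinite, pairwise distinct, and within distance 3 of `x`. -/
def Tri (ω : ℤ → ℤ × ℤ) : Set ℤ :=
  {x : ℤ | (ω x = (1, 1) ∨ ω x = (-1, -1)) ∧ (cluster ω x).supp.Infinite ∧
    ∃ yp yn : ℤ, IsLeast (straddleAbove ω x) yp ∧ IsLeast (straddleBelow ω x) yn ∧
      cluster ω yp ≠ cluster ω x ∧ cluster ω yn ≠ cluster ω x ∧
      cluster ω yp ≠ cluster ω yn ∧
      (∃ z ∈ (cluster ω yp).supp, |z - x| ≤ 3) ∧
      (∃ z ∈ (cluster ω yn).supp, |z - x| ≤ 3)}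

section Parentheses

variable {ε : ℤ → ℤ} {x y p q q' : ℤ}

theorem sum_Icc_eq_add_sum_Icc (ε : ℤ → ℤ) {a b c : ℤ} (hab : a ≤ b) (hbc : b - 1 ≤ c) :
    ∑ i ∈ Finset.Icc a c, ε i = ∑ i ∈ Finset.Icc a (b - 1), ε i + ∑ i ∈ Finset.Icc b c, ε i := by
  rw [← Finset.sum_union]
  · congr 1
    ext i
    simp only [Finset.mem_Icc, Finset.mem_union]
    omega
  · rw [Finset.disjoint_left]
    intro i
    simp only [Finset.mem_Icc]
    omega

theorem sum_Icc_eq_add_last (ε : ℤ → ℤ) {a c : ℤ} (hac : a ≤ c) :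
    ∑ i ∈ Finset.Icc a c, ε i = ∑ i ∈ Finset.Icc a (c - 1), ε i + ε c := by
  rw [sum_Icc_eq_add_sum_Icc ε hac (by omega), Finset.Icc_self, Finset.sum_singleton]

theorem Matched.right_unique (h : Matched ε x y) (h' : Matched ε x q) : y = q := by
  obtain ⟨hxy, -, -, hpos, hzero⟩ := h
  obtain ⟨hxq, -, -, hpos', hzero'⟩ := h'
  rcases lt_trichotomy y q with hlt | rfl | hlt
  · have := hpos' y hxy.le hlt
    omega
  · rfl
  · have := hpos q hxq.le hlt
    omega

theorem Matched.left_unique (h : Matched ε x y) (h' : Matched ε p y) : x = p := by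
  have key : ∀ {a b : ℤ}, Matched ε a y → Matched ε b y → ¬ a < b := by
    rintro a b ⟨-, -, -, hpos, hzero⟩ ⟨hby, -, -, -, hzero'⟩ hab
    have h₁ := hpos (b - 1) (by omega) (by omega)
    have h₂ := sum_Icc_eq_add_sum_Icc ε hab.le (show b - 1 ≤ y by omega)
    omega
  exact le_antisymm (not_lt.1 (key h' h)) (not_lt.1 (key h h'))

theorem MatchedSym.symm (h : MatchedSym ε p q) : MatchedSym ε q p := Or.symm h

theorem MatchedSym.ne (h : MatchedSym ε p q) : p ≠ q := by
  rcases h with h | h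
  · exact h.1.ne
  · exact h.1.ne'

theorem MatchedSym.unique (h : MatchedSym ε p q) (h' : MatchedSym ε p q') : q = q' := by
  rcases h with h | h <;> rcases h' with h' | h'
  · exact h.right_unique h'
  · have h₁ := h.2.1
    have h₂ := h'.2.2.1
    omega
  · have h₁ := h.2.2.1
    have h₂ := h'.2.1
    omega
  · exact h.left_unique h'

theorem MatchedSym.of_lt (h : MatchedSym ε p q) (hpq : p < q) : Matched ε p q := by
  rcases h with h | h
  · exact h
  · exact absurd h.1 hpq.not_gt

theorem Matched.exists_mate (hε : ∀ z, ε z = 1 ∨ ε z = -1) (h : Matched ε x y)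
    (hxp : x < p) (hpy : p < y) : ∃ q, x < q ∧ q < y ∧ MatchedSym ε p q := by
  obtain ⟨-, -, -, hpos, hzero⟩ := h
  have hstep : ∀ c, x ≤ c → ∑ i ∈ Finset.Icc x c, ε i =
      ∑ i ∈ Finset.Icc x (c - 1), ε i + ε c := fun c => sum_Icc_eq_add_last ε
  have hsplit : ∀ b c, x ≤ b → b - 1 ≤ c → ∑ i ∈ Finset.Icc x c, ε i =
      ∑ i ∈ Finset.Icc x (b - 1), ε i + ∑ i ∈ Finset.Icc b c, ε i :=
    fun b c => sum_Icc_eq_add_sum_Icc ε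
  have hempty : ∑ i ∈ Finset.Icc x (x - 1), ε i = 0 := by
    rw [Finset.Icc_eq_empty (by omega), Finset.sum_empty]
  have hp := hpos p hxp.le hpy
  have hp' := hpos (p - 1) (by omega) (by omega)
  have hpp := hstep p hxp.le
  generalize hF : (fun c => ∑ i ∈ Finset.Icc x c, ε i) = F at *
  have hF' : ∀ c, ∑ i ∈ Finset.Icc x c, ε i = F c := fun c => congrFun hF c
  simp only [hF'] at *
  rcases hε p with hεp | hεp
  · obtain ⟨q, ⟨hpq, hq⟩, hmin⟩ := Int.exists_least_of_bdd (P := fun q => p ≤ q ∧ F q ≤ F (p - 1))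
      ⟨p, fun z hz => hz.1⟩ ⟨y, hpy.le, by omega⟩
    have hlt : ∀ z, p ≤ z → z < q → F (p - 1) < F z := by
      intro z hpz hzq
      by_contra hcon
      have := hmin z ⟨hpz, not_lt.1 hcon⟩
      omega
    have hpq' : p < q := by
      rcases hpq.lt_or_eq with h | rfl
      · exact h
      · omega
    have h₁ := hlt (q - 1) (by omega) (by omega)
    have h₂ := hstep q (by omega)
    have hεq : ε q = -1 := by
      rcases hε q with h | h <;> omega
    have hqy : q ≤ y := hmin y ⟨hpy.le, by omega⟩
    have hqy' : q ≠ y := by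
      rintro rfl
      omega
    refine ⟨q, by omega, by omega, Or.inl ⟨hpq', hεp, hεq, ?_, ?_⟩⟩
    · intro z hpz hzq
      have := hlt z hpz hzq
      have := hsplit p z hxp.le (by omega)
      omega
    · have := hsplit p q hxp.le (by omega)
      omega
  · obtain ⟨q, ⟨hxq, hqp, hq⟩, hmax⟩ := Int.exists_greatest_of_bdd
      (P := fun q => x ≤ q ∧ q ≤ p ∧ F (q - 1) ≤ F p)
      ⟨p, fun z hz => hz.2.1⟩ ⟨x, le_rfl, hxp.le, by omega⟩
    have hlt : ∀ z, q ≤ z → z < p → F p < F z := by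
      intro z hqz hzp
      by_contra hcon
      have := hmax (z + 1) ⟨by omega, by omega, by simpa using hcon⟩
      omega
    have hqp' : q < p := by
      rcases hqp.lt_or_eq with h | rfl
      · exact h
      · omega
    have h₁ := hlt q le_rfl hqp'
    have h₂ := hstep q hxq
    have hεq : ε q = 1 := by
      rcases hε q with h | h <;> omega
    have hxq' : x ≠ q := by
      rintro rfl
      omega
    refine ⟨q, by omega, by omega, Or.inr ⟨hqp', hεq, hεp, ?_, ?_⟩⟩
    · intro z hqz hzp
      have := hlt z hqz hzp
      have := hsplit q z hxq (by omega)
      rcases hε q with h | h <;> omega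
    · have := hsplit q p hxq (by omega)
      rcases hε q with h | h <;> omega

theorem Matched.nested (hε : ∀ z, ε z = 1 ∨ ε z = -1) (h : Matched ε x y)
    (hxp : x < p) (hpy : p < y) (hpq : MatchedSym ε p q) : x < q ∧ q < y := by
  obtain ⟨q', hxq', hqy', h'⟩ := h.exists_mate hε hxp hpy
  rw [hpq.unique h']
  exact ⟨hxq', hqy'⟩

end Parentheses

/-- Triples of points of `V`, indexed by `S`, such that every triple `t` cuts the remaining triples
and points by three chords: `B t i s` and `Γ t i c` say that the triple `s` and the point `c` lie
beyond the chord of `t` opposite to its `i`-th vertex. If each triple lies beyond some chord of each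
other triple and touches only points on its own side, then there are at least two more
points than triples. -/
theorem card_triples_add_two_le {T V : Type*} [DecidableEq T] [DecidableEq V]
    (v : T → Fin 3 → V) (B : T → Fin 3 → T → Prop) (Γ : T → Fin 3 → V → Prop)
    (hv : ∀ t, Function.Injective (v t))
    (hΓ : ∀ t i, ¬ Γ t i (v t i))
    (htouch : ∀ t i s j, s ≠ t → (∀ k, k ≠ i → v s j ≠ v t k) → (B t i s ↔ Γ t i (v s j)))
    (hcover : ∀ t s, s ≠ t → ∃ i, B t i s)
    (S : Finset T) (hS : S.Nonempty) (W : Finset V) (hW : ∀ s ∈ S, ∀ j, v s j ∈ W) :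
    S.card + 2 ≤ W.card := by
  classical
  induction hn : S.card using Nat.strong_induction_on generalizing S W with
  | _ n ih =>
  obtain ⟨t, ht⟩ := hS
  set VT : Finset V := Finset.univ.image (v t) with hVT
  have hVTcard : VT.card = 3 := by
    rw [hVT, Finset.card_image_of_injective _ (hv t)]
    simp
  have hVTW : VT ⊆ W := by
    intro c hc
    obtain ⟨j, -, rfl⟩ := Finset.mem_image.1 hc
    exact hW t ht j
  let S' : Fin 3 → Finset T := fun i => {s ∈ S.erase t | B t i s ∧ ∀ j < i, ¬ B t j s}
  let X : Fin 3 → Finset V := fun i => {c ∈ W \ VT | Γ t i c ∧ ∀ j < i, ¬ Γ t j c}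
  have hle : ∀ i, (S' i).card ≤ (X i).card := by
    intro i
    rcases (S' i).eq_empty_or_nonempty with h | h
    · simp [h]
    have hlt : (S' i).card < n := by
      rw [← hn]
      refine (Finset.card_le_card (Finset.filter_subset _ _)).trans_lt ?_
      exact Finset.card_erase_lt_of_mem ht
    have hcard : ((VT.erase (v t i)) ∪ X i).card ≤ 2 + (X i).card := by
      refine (Finset.card_union_le _ _).trans ?_
      rw [Finset.card_erase_of_mem (Finset.mem_image_of_mem _ (Finset.mem_univ _)), hVTcard]
    have := ih _ hlt (S' i) h ((VT.erase (v t i)) ∪ X i) ?_ rfl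
    · omega
    intro s hs j
    simp only [S', Finset.mem_filter, Finset.mem_erase] at hs
    obtain ⟨⟨hst, hsS⟩, hB, hB'⟩ := hs
    rw [Finset.mem_union]
    by_cases hj : ∃ k, k ≠ i ∧ v s j = v t k
    · obtain ⟨k, hki, hk⟩ := hj
      left
      rw [hk, Finset.mem_erase]
      exact ⟨fun h => hki (hv t h), Finset.mem_image_of_mem _ (Finset.mem_univ _)⟩
    · push Not at hj
      right
      have hΓi := (htouch t i s j hst hj).1 hB
      have hnot : ∀ k, v s j ≠ v t k := by
        intro k hk
        by_cases hki : k = i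
        · subst hki
          exact hΓ t k (hk ▸ hΓi)
        · exact hj k hki hk
      simp only [X, Finset.mem_filter, Finset.mem_sdiff]
      refine ⟨⟨hW s hsS j, ?_⟩, hΓi, fun k hk h => ?_⟩
      · rintro hmem
        obtain ⟨k, -, hk⟩ := Finset.mem_image.1 hmem
        exact hnot k hk.symm
      · exact hB' k hk ((htouch t k s j hst fun l _ => hnot l).2 h)
  have hSsub : S.erase t ⊆ Finset.univ.biUnion S' := by
    intro s hs
    obtain ⟨i, hi⟩ := hcover t s (Finset.ne_of_mem_erase hs)
    rw [Finset.mem_biUnion]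
    have hne : (Finset.univ.filter fun i => B t i s).Nonempty := ⟨i, by simpa using hi⟩
    refine ⟨Finset.min' _ hne, Finset.mem_univ _, ?_⟩
    simp only [S', Finset.mem_filter]
    refine ⟨hs, ?_, fun j hj hB => ?_⟩
    · simpa using Finset.min'_mem _ hne
    · exact absurd (Finset.min'_le _ j (by simpa using hB)) (not_le.2 hj)
  have hXsub : Finset.univ.biUnion X ⊆ W \ VT :=
    Finset.biUnion_subset.2 fun i _ => Finset.filter_subset _ _
  have hXdisj : ((Finset.univ : Finset (Fin 3)) : Set (Fin 3)).PairwiseDisjoint X := by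
    intro i _ j _ hij
    rw [Function.onFun, Finset.disjoint_left]
    intro c hci hcj
    simp only [X, Finset.mem_filter] at hci hcj
    rcases lt_or_gt_of_ne hij with h | h
    · exact hcj.2.2 i h hci.2.1
    · exact hci.2.2 j h hcj.2.1
  have h₁ := (Finset.card_le_card hSsub).trans Finset.card_biUnion_le
  have h₂ := Finset.card_le_card hXsub
  rw [Finset.card_biUnion hXdisj, Finset.card_sdiff_of_subset hVTW, hVTcard] at h₂
  have h₃ := Finset.sum_le_sum fun i (_ : i ∈ Finset.univ) => hle i
  rw [Finset.card_erase_of_mem ht] at h₁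
  have h₄ := Finset.card_le_card hVTW
  omega

section Clusters

/-- The upper (`b = true`) or lower (`b = false`) sequence of parentheses of `ω`. -/
def par (ω : ℤ → ℤ × ℤ) (b : Bool) : ℤ → ℤ := fun z => cond b (ω z).1 (ω z).2

variable {ω : ℤ → ℤ × ℤ} {b : Bool} {p q v w : ℤ}

theorem matchingGraph_adj :
    (matchingGraph ω).Adj p q ↔ ∃ b, MatchedSym (par ω b) p q := by
  rw [matchingGraph, SimpleGraph.fromRel_adj]
  constructor
  · rintro ⟨-, (h | h) | (h | h)⟩
    exacts [⟨true, Or.inl h⟩, ⟨false, Or.inl h⟩, ⟨true, Or.inr h⟩, ⟨false, Or.inr h⟩]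
  · rintro ⟨_ | _, h⟩
    · exact ⟨h.ne, h.imp Or.inr Or.inr⟩
    · exact ⟨h.ne, h.imp Or.inl Or.inl⟩

theorem MatchedSym.adj (h : MatchedSym (par ω b) p q) : (matchingGraph ω).Adj p q :=
  matchingGraph_adj.2 ⟨b, h⟩

theorem cluster_eq_of_adj (h : (matchingGraph ω).Adj p q) : cluster ω p = cluster ω q :=
  SimpleGraph.ConnectedComponent.sound h.reachable

theorem MatchedSym.cluster_eq (h : MatchedSym (par ω b) p q) : cluster ω p = cluster ω q :=
  cluster_eq_of_adj h.adj

theorem cluster_eq_iff_reachable :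
    cluster ω p = cluster ω q ↔ (matchingGraph ω).Reachable p q :=
  SimpleGraph.ConnectedComponent.eq

theorem mem_supp_cluster : p ∈ (cluster ω q).supp ↔ cluster ω p = cluster ω q :=
  SimpleGraph.ConnectedComponent.mem_supp_iff _ _

theorem mem_of_cluster_eq {S : Set ℤ} (hS : ∀ v ∈ S, ∀ w, (matchingGraph ω).Adj v w → w ∈ S)
    (hp : p ∈ S) (h : cluster ω p = cluster ω q) : q ∈ S := by
  obtain ⟨c⟩ := cluster_eq_iff_reachable.1 h
  induction c with
  | nil => exact hp
  | cons hadj _ ih => exact ih (hS _ hp _ hadj) (by rw [← h, cluster_eq_of_adj hadj])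

theorem finite_supp_cluster {S : Set ℤ} (hfin : S.Finite)
    (hS : ∀ v ∈ S, ∀ w, (matchingGraph ω).Adj v w → w ∈ S) (hp : p ∈ S) :
    (cluster ω p).supp.Finite :=
  hfin.subset fun _ hq => mem_of_cluster_eq hS hp (mem_supp_cluster.1 hq).symm

theorem neighborSet_subset_pair (v : ℤ) :
    ∃ w₁ w₂ : ℤ, (matchingGraph ω).neighborSet v ⊆ {w₁, w₂} := by
  have h : ∀ b, ∃ w, ∀ u, MatchedSym (par ω b) v u → u = w := by
    intro b
    by_cases h : ∃ w, MatchedSym (par ω b) v w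
    · obtain ⟨w, hw⟩ := h
      exact ⟨w, fun u hu => hu.unique hw⟩
    · exact ⟨0, fun u hu => absurd ⟨u, hu⟩ h⟩
  obtain ⟨w₁, h₁⟩ := h true
  obtain ⟨w₂, h₂⟩ := h false
  refine ⟨w₁, w₂, fun u hu => ?_⟩
  obtain ⟨_ | _, hb⟩ := matchingGraph_adj.1 hu
  · exact Or.inr (h₂ u hb)
  · exact Or.inl (h₁ u hb)

theorem isBridge_of_infinite (hadj : (matchingGraph ω).Adj p q)
    (hinf : (cluster ω p).supp.Infinite) : (matchingGraph ω).IsBridge s(p, q) := by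
  rw [SimpleGraph.isBridge_iff_forall_cycle_notMem hadj]
  intro u c hc hmem
  refine hinf (finite_supp_cluster (S := {v | v ∈ c.support}) c.support.finite_toSet ?_
    (c.fst_mem_support_of_mem_edges hmem))
  intro v hv w hvw
  obtain ⟨w₁, w₂, hN⟩ := neighborSet_subset_pair (ω := ω) v
  have hfin : ((matchingGraph ω).neighborSet v).Finite := (Set.toFinite {w₁, w₂}).subset hN
  have hcard : ((matchingGraph ω).neighborSet v).ncard ≤ 2 :=
    (Set.ncard_le_ncard hN).trans ((Set.ncard_insert_le _ _).trans (by simp))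
  have heq := Set.eq_of_subset_of_ncard_le (c.toSubgraph.neighborSet_subset v)
    (hcard.trans (hc.ncard_neighborSet_toSubgraph_eq_two hv).ge) hfin
  have hw : w ∈ c.toSubgraph.neighborSet v := heq ▸ hvw
  exact c.mem_verts_toSubgraph.1 (c.toSubgraph.edge_vert hw.symm)

/-- `H` is the half of the cluster of `p` containing `p` that remains after cutting the arc of
type `b` from `p` to `q`. -/
structure IsHalf (ω : ℤ → ℤ × ℤ) (b : Bool) (p q : ℤ) (H : Set ℤ) : Prop where
  matched : MatchedSym (par ω b) p q
  infinite : (cluster ω p).supp.Infinite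
  mem : p ∈ H
  notMem : q ∉ H
  cluster_eq : ∀ v ∈ H, cluster ω v = cluster ω p
  same : ∀ v ∈ H, ∀ w, v ≠ p → MatchedSym (par ω b) v w → w ∈ H
  other : ∀ v ∈ H, ∀ w, MatchedSym (par ω (!b)) v w → w ∈ H

theorem not_matchedSym_both (hinf : (cluster ω p).supp.Infinite)
    (h : MatchedSym (par ω b) p q) : ¬ MatchedSym (par ω (!b)) p q := by
  intro h'
  refine hinf (finite_supp_cluster (S := {p, q}) (Set.toFinite _) ?_ (Or.inl rfl))
  rintro v hv w hvw
  obtain ⟨c, hc⟩ := matchingGraph_adj.1 hvw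
  have hpq : ∀ c, MatchedSym (par ω c) p q := by
    intro c
    cases b <;> cases c <;> assumption
  rcases hv with rfl | rfl
  · exact Or.inr (hc.unique (hpq c))
  · exact Or.inl (hc.unique (hpq c).symm)

theorem exists_isHalf (h : MatchedSym (par ω b) p q) (hinf : (cluster ω p).supp.Infinite) :
    ∃ H, IsHalf ω b p q H := by
  have hbr := SimpleGraph.isBridge_iff.1 (isBridge_of_infinite h.adj hinf)
  set G' := (matchingGraph ω).deleteEdges {s(p, q)} with hG'
  have hstep : ∀ v w, G'.Reachable p v → (matchingGraph ω).Adj v w → s(v, w) ≠ s(p, q) →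
      G'.Reachable p w := by
    intro v w hv hvw hne
    refine hv.trans (SimpleGraph.Adj.reachable ?_)
    rw [hG', SimpleGraph.deleteEdges_adj]
    exact ⟨hvw, hne⟩
  refine ⟨{v | G'.Reachable p v}, h, hinf, SimpleGraph.Reachable.refl _, hbr, ?_, ?_, ?_⟩
  · intro v hv
    exact (cluster_eq_iff_reachable.2 (hv.mono (SimpleGraph.deleteEdges_le _))).symm
  · intro v hv w hvp hvw
    refine hstep v w hv hvw.adj fun heq => ?_
    rcases Sym2.eq_iff.1 heq with ⟨rfl, -⟩ | ⟨rfl, -⟩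
    · exact hvp rfl
    · exact hbr hv
  · intro v hv w hvw
    refine hstep v w hv hvw.adj fun heq => ?_
    rcases Sym2.eq_iff.1 heq with ⟨rfl, rfl⟩ | ⟨rfl, -⟩
    · exact not_matchedSym_both hinf h hvw
    · exact hbr hv

end Clusters

section Parity

open Classical in
/-- The parity of the number of elements of `H` between `0` and `v`. -/
noncomputable def parity (H : Set ℤ) (v : ℤ) : ZMod 2 :=
  ∑ i ∈ Finset.Ioc 0 v, (if i ∈ H then 1 else 0) + ∑ i ∈ Finset.Ioc v 0, (if i ∈ H then 1 else 0)

open Classical in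
theorem parity_add_one (H : Set ℤ) (v : ℤ) :
    parity H (v + 1) = parity H v + if v + 1 ∈ H then 1 else 0 := by
  unfold parity
  rcases le_or_gt 0 v with h | h
  · rw [Finset.Ioc_eq_empty (a := v) (by omega), Finset.Ioc_eq_empty (a := v + 1) (by omega),
      show Finset.Ioc 0 (v + 1) = insert (v + 1) (Finset.Ioc 0 v) by
        ext i; simp only [Finset.mem_Ioc, Finset.mem_insert]; omega,
      Finset.sum_insert (by simp)]
    ring
  · rw [Finset.Ioc_eq_empty (b := v) (by omega), Finset.Ioc_eq_empty (b := v + 1) (by omega),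
      show Finset.Ioc v 0 = insert (v + 1) (Finset.Ioc (v + 1) 0) by
        ext i; simp only [Finset.mem_Ioc, Finset.mem_insert]; omega,
      Finset.sum_insert (by simp)]
    grind

theorem parity_sub_one {H : Set ℤ} {v : ℤ} (hv : v ∉ H) : parity H (v - 1) = parity H v := by
  have h := parity_add_one H (v - 1)
  rw [sub_add_cancel, if_neg hv, add_zero] at h
  exact h.symm

open Classical in
theorem parity_add_parity (H : Set ℤ) {a c : ℤ} (hac : a ≤ c) :
    parity H a + parity H c = ∑ i ∈ Finset.Ioc a c with i ∈ H, 1 := by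
  induction c, hac using Int.leInduction with
  | base => simp [CharTwo.add_self_eq_zero]
  | succ c hac ih =>
    rw [show Finset.Ioc a (c + 1) = insert (c + 1) (Finset.Ioc a c) by
        ext i; simp only [Finset.mem_Ioc, Finset.mem_insert]; omega, Finset.filter_insert,
      parity_add_one, ← add_assoc, ih]
    split_ifs with h
    · rw [Finset.sum_insert (by simp), add_comm]
    · rw [add_zero]

theorem sum_one_eq_zero_of_paired {S : Finset ℤ} {ε : ℤ → ℤ}
    (h : ∀ p ∈ S, ∃ q ∈ S, MatchedSym ε p q) : ∑ _i ∈ S, (1 : ZMod 2) = 0 := by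
  choose! g hg hgm using h
  exact Finset.sum_involution (fun a _ => g a) (fun _ _ => by decide)
    (fun a ha _ => (MatchedSym.ne (hgm a ha)).symm) (fun a ha => hg a ha)
    (fun a ha => (hgm (g a) (hg a ha)).unique (hgm a ha).symm)

variable {ω : ℤ → ℤ × ℤ} {b : Bool} {p q a c : ℤ} {H : Set ℤ}

/-- The points of infinite clusters in the interval `(a, c]` are paired among themselves by the
arcs of type `b`, and `a` is the left end of an arc of type `b` covering the interval. -/
structure IsSeg (ω : ℤ → ℤ × ℤ) (b : Bool) (a c : ℤ) : Prop where
  le : a ≤ c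
  infinite : (cluster ω a).supp.Infinite
  covered : ∃ d, c < d ∧ Matched (par ω b) a d
  paired : ∀ p, a < p → p ≤ c → (cluster ω p).supp.Infinite →
    ∃ q, a < q ∧ q ≤ c ∧ MatchedSym (par ω b) p q

theorem Matched.isSeg (hε : ∀ b z, par ω b z = 1 ∨ par ω b z = -1) (h : Matched (par ω b) a c)
    (hinf : (cluster ω a).supp.Infinite) : IsSeg ω b a (c - 1) := by
  have hac := h.1
  refine ⟨by omega, hinf, ⟨c, by omega, h⟩, fun p hap hpc _ => ?_⟩
  obtain ⟨q, h₁, h₂, h₃⟩ := h.exists_mate (hε b) hap (by omega)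
  exact ⟨q, h₁, by omega, h₃⟩

theorem IsHalf.parity_other (hH : IsHalf ω b p q H) (hI : IsSeg ω (!b) a c) :
    parity H a + parity H c = 0 := by
  classical
  rw [parity_add_parity H hI.le]
  refine sum_one_eq_zero_of_paired (ε := par ω (!b)) fun v hv => ?_
  rw [Finset.mem_filter, Finset.mem_Ioc] at hv
  obtain ⟨⟨hav, hvc⟩, hvH⟩ := hv
  obtain ⟨w, haw, hwc, hvw⟩ := hI.paired v hav hvc (hH.cluster_eq v hvH ▸ hH.infinite)
  exact ⟨w, Finset.mem_filter.2 ⟨Finset.mem_Ioc.2 ⟨haw, hwc⟩, hH.other v hvH w hvw⟩, hvw⟩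

open Classical in
theorem IsHalf.parity_same (hH : IsHalf ω b p q H) (hI : IsSeg ω b a c) :
    parity H a + parity H c = if a < p ∧ p ≤ c then 1 else 0 := by
  have hsum : ∑ _i ∈ ({i ∈ Finset.Ioc a c | i ∈ H}.erase p), (1 : ZMod 2) = 0 := by
    refine sum_one_eq_zero_of_paired (ε := par ω b) fun v hv => ?_
    rw [Finset.mem_erase, Finset.mem_filter, Finset.mem_Ioc] at hv
    obtain ⟨hvp, ⟨hav, hvc⟩, hvH⟩ := hv
    obtain ⟨w, haw, hwc, hvw⟩ := hI.paired v hav hvc (hH.cluster_eq v hvH ▸ hH.infinite)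
    have hwH := hH.same v hvH w hvp hvw
    refine ⟨w, Finset.mem_erase.2 ⟨?_, Finset.mem_filter.2 ⟨Finset.mem_Ioc.2 ⟨haw, hwc⟩, hwH⟩⟩, hvw⟩
    rintro rfl
    exact hH.notMem (hvw.symm.unique hH.matched ▸ hvH)
  rw [parity_add_parity H hI.le]
  split_ifs with h
  · have hp : p ∈ ({i ∈ Finset.Ioc a c | i ∈ H}) :=
      Finset.mem_filter.2 ⟨Finset.mem_Ioc.2 h, hH.mem⟩
    rw [← Finset.add_sum_erase _ _ hp, hsum, add_zero]
  · rwa [Finset.erase_eq_of_notMem] at hsum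
    simpa [hH.mem] using h

end Parity

section Tripods

/-- A trifurcation point `x` together with the innermost arcs of infinite clusters straddling it
above (`z true`, `y true`) and below (`z false`, `y false`), and the gap `(g, g + 1)` next to `x` on
the side opposite to the arcs of `x`. -/
structure Tripod (ω : ℤ → ℤ × ℤ) (x : ℤ) where
  z : Bool → ℤ
  y : Bool → ℤ
  g : ℤ
  gap : (g = x - 1 ∧ ∀ b, par ω b x = 1) ∨ (g = x ∧ ∀ b, par ω b x = -1)
  matched : ∀ b, Matched (par ω b) (z b) (y b)
  lt : ∀ b, z b < x
  gt : ∀ b, x < y b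
  infinite : (cluster ω x).supp.Infinite
  infinite_arc : ∀ b, (cluster ω (z b)).supp.Infinite
  innermost : ∀ b p q, Matched (par ω b) p q → p < x → x < q →
    (cluster ω p).supp.Infinite → p ≤ z b ∧ y b ≤ q
  ne_self : ∀ b, cluster ω (z b) ≠ cluster ω x
  ne_other : cluster ω (z true) ≠ cluster ω (z false)

theorem exists_innermost_arc {ω : ℤ → ℤ × ℤ} (hε : ∀ b z, par ω b z = 1 ∨ par ω b z = -1) (b : Bool)
    {x y : ℤ} (h : IsLeast {y : ℤ | x < y ∧ ∃ z < x, MatchedSym (par ω b) z y ∧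
      (cluster ω y).supp.Infinite} y) :
    ∃ z, Matched (par ω b) z y ∧ z < x ∧ x < y ∧ cluster ω z = cluster ω y ∧
      (cluster ω z).supp.Infinite ∧ ∀ p q, Matched (par ω b) p q → p < x → x < q →
        (cluster ω p).supp.Infinite → p ≤ z ∧ y ≤ q := by
  obtain ⟨⟨hxy, z, hzx, hzy, hinf⟩, hmin⟩ := h
  have hm := hzy.of_lt (hzx.trans hxy)
  refine ⟨z, hm, hzx, hxy, hzy.cluster_eq, hzy.cluster_eq ▸ hinf, fun p q hpq hpx hxq hp => ?_⟩
  have hq : y ≤ q :=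
    hmin ⟨hxq, p, hpx, Or.inl hpq, MatchedSym.cluster_eq (Or.inl hpq) ▸ hp⟩
  refine ⟨?_, hq⟩
  by_contra hcon
  have := hm.nested (hε b) (not_le.1 hcon) (hpx.trans hxy) (Or.inl hpq)
  omega

theorem nonempty_tripod {ω : ℤ → ℤ × ℤ} (hε : ∀ b z, par ω b z = 1 ∨ par ω b z = -1) {x : ℤ}
    (hx : x ∈ Tri ω) : Nonempty (Tripod ω x) := by
  obtain ⟨hconf, hinf, yp, yn, hyp, hyn, hpx, hnx, hpn, -, -⟩ := hx
  obtain ⟨zp, hp₁, hp₂, hp₃, hp₄, hp₅, hp₆⟩ := exists_innermost_arc hε true hyp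
  obtain ⟨zn, hn₁, hn₂, hn₃, hn₄, hn₅, hn₆⟩ := exists_innermost_arc hε false hyn
  obtain ⟨g, hg⟩ : ∃ g, (g = x - 1 ∧ ∀ b, par ω b x = 1) ∨ (g = x ∧ ∀ b, par ω b x = -1) := by
    rcases hconf with h | h
    · exact ⟨x - 1, Or.inl ⟨rfl, by rintro (_ | _) <;> simp [par, h]⟩⟩
    · exact ⟨x, Or.inr ⟨rfl, by rintro (_ | _) <;> simp [par, h]⟩⟩
  exact ⟨{
    z := fun b => cond b zp zn
    y := fun b => cond b yp yn
    g := g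
    gap := hg
    matched := by rintro (_ | _) <;> assumption
    lt := by rintro (_ | _) <;> assumption
    gt := by rintro (_ | _) <;> assumption
    infinite := hinf
    infinite_arc := by rintro (_ | _) <;> assumption
    innermost := by rintro (_ | _) <;> assumption
    ne_self := by
      rintro (_ | _)
      · exact hn₄ ▸ hnx
      · exact hp₄ ▸ hpx
    ne_other := by simpa only [cond_true, cond_false, hp₄, hn₄] using hpn }⟩

namespace Tripod

variable {ω : ℤ → ℤ × ℤ} {x : ℤ}

theorem isSeg (hε : ∀ b z, par ω b z = 1 ∨ par ω b z = -1) (t : Tripod ω x) (b : Bool) :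
    IsSeg ω b (t.z b) t.g := by
  have hlt := t.lt b
  have hgt := t.gt b
  have hg : t.g ≤ x ∧ x - 1 ≤ t.g := by
    rcases t.gap with ⟨h, -⟩ | ⟨h, -⟩ <;> omega
  refine ⟨by omega, t.infinite_arc b, ⟨t.y b, by omega, t.matched b⟩, fun p hap hpc hp => ?_⟩
  obtain ⟨q, h₁, h₂, hpq⟩ := (t.matched b).exists_mate (hε b) hap (by omega)
  refine ⟨q, h₁, ?_, hpq⟩
  by_contra hcon
  have hm := hpq.of_lt (by omega)
  rcases t.gap with ⟨hgx, h⟩ | ⟨hgx, h⟩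
  · rcases eq_or_ne q x with rfl | hqx
    · have h₃ := hm.2.2.1
      rw [h b] at h₃
      omega
    · have := (t.innermost b p q hm (by omega) (by omega) hp).1
      omega
  · rcases eq_or_ne p x with rfl | hpx
    · have h₃ := hm.2.1
      rw [h b] at h₃
      omega
    · have := (t.innermost b p q hm (by omega) (by omega) hp).1
      omega

theorem exists_mate (hε : ∀ b z, par ω b z = 1 ∨ par ω b z = -1) (t : Tripod ω x) (b : Bool) :
    ∃ p, MatchedSym (par ω b) p x := by
  obtain ⟨p, -, -, h⟩ := (t.matched b).exists_mate (hε b) (t.lt b) (t.gt b)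
  exact ⟨p, h.symm⟩

open Classical in
theorem parity_arc (t : Tripod ω x) {b : Bool}
    {H : Set ℤ} (hH : IsHalf ω b (t.z b) (t.y b) H) {a c : ℤ} (hI : IsSeg ω b a c)
    (ha : cluster ω a ≠ cluster ω (t.z b)) :
    parity H a + parity H c = if a < x ∧ x ≤ c then 1 else 0 := by
  rw [hH.parity_same hI]
  congr 1
  have hlt := t.lt b
  have hgt := t.gt b
  have haz : a ≠ t.z b := fun h => ha (by rw [h])
  rw [eq_iff_iff]
  constructor
  · rintro ⟨h₁, h₂⟩
    obtain ⟨q, haq, hqc, hq⟩ := hI.paired _ h₁ h₂ (t.infinite_arc b)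
    rw [hq.unique (Or.inl (t.matched b))] at hqc
    omega
  · rintro ⟨h₁, h₂⟩
    obtain ⟨d, hcd, hd⟩ := hI.covered
    have := (t.innermost b a d hd h₁ (by omega) hI.infinite).1
    omega

open Classical in
theorem parity_self (t : Tripod ω x) {b : Bool} {p : ℤ}
    {H : Set ℤ} (hH : IsHalf ω b p x H) {a c : ℤ} (hI : IsSeg ω b a c) :
    parity H a + parity H c = if a < x ∧ x ≤ c then 1 else 0 := by
  rw [hH.parity_same hI]
  congr 1
  rw [eq_iff_iff]
  constructor
  · rintro ⟨h₁, h₂⟩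
    obtain ⟨q, haq, hqc, hq⟩ := hI.paired _ h₁ h₂ hH.infinite
    rw [hq.unique hH.matched] at haq hqc
    exact ⟨haq, hqc⟩
  · rintro ⟨h₁, h₂⟩
    obtain ⟨q, haq, hqc, hq⟩ := hI.paired _ h₁ h₂ t.infinite
    rw [hq.unique hH.matched.symm] at haq hqc
    exact ⟨haq, hqc⟩

end Tripod

/-- A tripod together with a choice of one half of each of its three clusters, which bounds the
three sectors cut out by the tripod. -/
structure Cut (ω : ℤ → ℤ × ℤ) (x : ℤ) extends Tripod ω x where
  U : Bool → Set ℤ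
  isHalf_U : ∀ b, IsHalf ω b (z b) (y b) (U b)
  mate : ℤ
  A : Set ℤ
  isHalf_A : IsHalf ω true mate x A

theorem nonempty_cut {ω : ℤ → ℤ × ℤ} (hε : ∀ b z, par ω b z = 1 ∨ par ω b z = -1) {x : ℤ}
    (hx : x ∈ Tri ω) : Nonempty (Cut ω x) := by
  obtain ⟨t⟩ := nonempty_tripod hε hx
  choose U hU using fun b => exists_isHalf (Or.inl (t.matched b)) (t.infinite_arc b)
  obtain ⟨p, hp⟩ := t.exists_mate hε true
  obtain ⟨A, hA⟩ := exists_isHalf hp (hp.cluster_eq ▸ t.infinite)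
  exact ⟨{ t with U := U, isHalf_U := hU, mate := p, A := A, isHalf_A := hA }⟩

namespace Cut

variable {ω : ℤ → ℤ × ℤ} {x x' : ℤ}

/-- Representatives of the three clusters of a tripod. -/
def point (t : Cut ω x) : Fin 3 → ℤ := ![x, t.z true, t.z false]

/-- The parity of the number of points before `v` of the chord opposite to the `i`-th cluster,
not counting the vertical segment at `x`. -/
noncomputable def chordParity (t : Cut ω x) (i : Fin 3) (v : ℤ) : ZMod 2 :=
  ![parity (t.U true) v + parity (t.U false) v, parity t.A v + parity (t.U false) v,
    parity t.A v + parity (t.U true) v] i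

/-- The contribution of the vertical segment at `x` to the chord opposite to the `i`-th cluster,
seen from a point which is to the left of the segment iff `P` holds. -/
noncomputable def segmentParity (i : Fin 3) (P : Prop) : ZMod 2 :=
  open Classical in if i ≠ 2 ∧ P then 1 else 0

/-- The side of the point `v` with respect to the chord opposite to the `i`-th cluster. -/
noncomputable def side (t : Cut ω x) (i : Fin 3) (v : ℤ) : ZMod 2 :=
  t.chordParity i v + segmentParity i (v ≤ t.g)

/-- The side of the tripod `s` with respect to the chord of `t` opposite to the `i`-th cluster. -/
noncomputable def sideTripod (t : Cut ω x) (i : Fin 3) (s : Cut ω x') : ZMod 2 :=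
  t.chordParity i s.g + segmentParity i (x' < x)

theorem g_eq (t : Cut ω x) : t.g = x - 1 ∨ t.g = x :=
  t.gap.imp And.left And.left

theorem g_eq_sub_one {t : Cut ω x} {b : Bool} (h : par ω b x = 1) : t.g = x - 1 := by
  rcases t.gap with ⟨hg, -⟩ | ⟨-, hb⟩
  · exact hg
  · rw [hb b] at h
    omega

theorem g_eq_self {t : Cut ω x} {b : Bool} (h : par ω b x = -1) : t.g = x := by
  rcases t.gap with ⟨-, hb⟩ | ⟨hg, -⟩
  · rw [hb b] at h
    omega
  · exact hg

theorem chordParity_isSeg (t : Cut ω x) {i : Fin 3} {b : Bool} {a c : ℤ} (hI : IsSeg ω b a c)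
    (ha : ∀ k, k ≠ i → cluster ω a ≠ cluster ω (t.point k)) :
    t.chordParity i a + t.chordParity i c = segmentParity i (a < x ∧ x ≤ c) := by
  have h₁ : i ≠ 1 → cluster ω a ≠ cluster ω (t.z true) := fun h => ha 1 h.symm
  have h₂ : i ≠ 2 → cluster ω a ≠ cluster ω (t.z false) := fun h => ha 2 h.symm
  cases b
  · have hA := t.isHalf_A.parity_other hI
    have hU := (t.isHalf_U true).parity_other hI
    have hV := fun h => t.parity_arc (t.isHalf_U false) hI (h₂ h)
    fin_cases i <;> simp [chordParity, segmentParity] at hV ⊢ <;> grind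
  · have hA := t.parity_self t.isHalf_A hI
    have hU := fun h => t.parity_arc (t.isHalf_U true) hI (h₁ h)
    have hV := (t.isHalf_U false).parity_other hI
    fin_cases i <;> simp [chordParity, segmentParity] at hU ⊢ <;> grind

theorem chordParity_sub_one (t : Cut ω x) {i : Fin 3} {v : ℤ}
    (hv : ∀ k, k ≠ i → cluster ω v ≠ cluster ω (t.point k)) :
    t.chordParity i (v - 1) = t.chordParity i v := by
  have h₀ : i ≠ 0 → parity t.A (v - 1) = parity t.A v := fun h => parity_sub_one fun hmem =>
    hv 0 h.symm ((t.isHalf_A.cluster_eq v hmem).trans t.isHalf_A.matched.cluster_eq)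
  have h₁ : i ≠ 1 → parity (t.U true) (v - 1) = parity (t.U true) v := fun h =>
    parity_sub_one fun hmem => hv 1 h.symm ((t.isHalf_U true).cluster_eq v hmem)
  have h₂ : i ≠ 2 → parity (t.U false) (v - 1) = parity (t.U false) v := fun h =>
    parity_sub_one fun hmem => hv 2 h.symm ((t.isHalf_U false).cluster_eq v hmem)
  fin_cases i <;> simp [chordParity] at h₀ h₁ h₂ ⊢ <;> simp [*]

theorem side_matched (hε : ∀ b z, par ω b z = 1 ∨ par ω b z = -1) (t : Cut ω x) {i : Fin 3}
    {b : Bool} {v w : ℤ} (hvw : Matched (par ω b) v w) (hinf : (cluster ω v).supp.Infinite)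
    (hv : ∀ k, k ≠ i → cluster ω v ≠ cluster ω (t.point k)) : t.side i v = t.side i w := by
  have h₁ := t.chordParity_isSeg (hvw.isSeg hε hinf) hv
  rw [t.chordParity_sub_one (MatchedSym.cluster_eq (Or.inl hvw) ▸ hv)] at h₁
  have hlt := hvw.1
  have h₂ : v = x → t.g = x - 1 := fun h => g_eq_sub_one (h ▸ hvw.2.1)
  have h₃ : w = x → t.g = x := fun h => g_eq_self (h ▸ hvw.2.2.1)
  have hg := t.g_eq
  have h₄ : segmentParity i (v ≤ t.g) + segmentParity i (w ≤ t.g) =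
      segmentParity i (v < x ∧ x ≤ w - 1) := by
    unfold segmentParity
    split_ifs <;> first | rfl | (exfalso; omega)
  unfold side
  grind

theorem side_eq_of_cluster_eq (hε : ∀ b z, par ω b z = 1 ∨ par ω b z = -1) (t : Cut ω x)
    {i : Fin 3} {v w : ℤ} (hinf : (cluster ω v).supp.Infinite)
    (hv : ∀ k, k ≠ i → cluster ω v ≠ cluster ω (t.point k)) (hvw : cluster ω v = cluster ω w) :
    t.side i v = t.side i w := by
  suffices h : w ∈ {u | cluster ω u = cluster ω v ∧ t.side i v = t.side i u} from h.2
  refine mem_of_cluster_eq ?_ ⟨rfl, rfl⟩ hvw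
  rintro u ⟨hu, hside⟩ u' huu'
  have hu' := (cluster_eq_of_adj huu').symm.trans hu
  obtain ⟨b, h | h⟩ := matchingGraph_adj.1 huu'
  · exact ⟨hu', hside.trans (t.side_matched hε h (hu ▸ hinf) (hu ▸ hv))⟩
  · exact ⟨hu', hside.trans (t.side_matched hε h (hu' ▸ hinf) (hu' ▸ hv)).symm⟩

theorem side_point (hε : ∀ b z, par ω b z = 1 ∨ par ω b z = -1) (t : Cut ω x) (s : Cut ω x')
    (hx : x' ≠ x) {i j : Fin 3}
    (hj : ∀ k, k ≠ i → cluster ω (s.point j) ≠ cluster ω (t.point k)) :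
    t.side i (s.point j) = t.sideTripod i s := by
  have hg := t.g_eq
  have hg' := s.g_eq
  have harc : ∀ b, (∀ k, k ≠ i → cluster ω (s.z b) ≠ cluster ω (t.point k)) →
      t.side i (s.z b) = t.sideTripod i s := by
    intro b hb
    have h₁ := t.chordParity_isSeg (s.isSeg hε b) hb
    have hlt := s.lt b
    have h₂ : s.z b = x → t.g = x - 1 := fun h => g_eq_sub_one (h ▸ (s.matched b).2.1)
    have h₃ : segmentParity i (s.z b ≤ t.g) + segmentParity i (x' < x) =
        segmentParity i (s.z b < x ∧ x ≤ s.g) := by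
      unfold segmentParity
      split_ifs <;> first | rfl | (exfalso; omega)
    unfold side sideTripod
    grind
  have hself : (∀ k, k ≠ i → cluster ω x' ≠ cluster ω (t.point k)) →
      t.side i x' = t.sideTripod i s := by
    intro h
    have h₁ : t.chordParity i s.g = t.chordParity i x' := by
      rcases hg' with h' | h' <;> rw [h']
      exact t.chordParity_sub_one h
    have h₂ : x' ≤ t.g ↔ x' < x := by omega
    rw [side, sideTripod, h₁, h₂]
  fin_cases j
  · exact hself hj
  · exact harc true hj
  · exact harc false hj

theorem exists_sideTripod_ne (hε : ∀ b z, par ω b z = 1 ∨ par ω b z = -1) (t : Cut ω x)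
    (s : Cut ω x') : ∃ i, t.sideTripod i s ≠ t.side i (t.point i) := by
  by_contra! hcon
  have h₀ := hcon 0
  have h₁ := hcon 1
  have h₂ := hcon 2
  have hz := t.lt true
  have hz' := t.lt false
  have hg := t.g_eq
  have hle : t.z true ≤ t.g := by omega
  have hx : ∀ H : Set ℤ, x ∉ H → parity H x = parity H t.g := by
    intro H hH
    rcases hg with h | h <;> rw [h]
    exact (parity_sub_one hH).symm
  have hxU : ∀ b, x ∉ t.U b := fun b h => t.ne_self b ((t.isHalf_U b).cluster_eq x h).symm
  have e₁ := hx _ (hxU true)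
  have e₂ := hx _ (hxU false)
  have e₃ := t.parity_self t.isHalf_A (t.isSeg hε true)
  have e₄ := (t.isHalf_U false).parity_other (t.isSeg hε true)
  have e₅ := t.isHalf_A.parity_other (t.isSeg hε false)
  have e₆ := (t.isHalf_U true).parity_other (t.isSeg hε false)
  simp [side, sideTripod, chordParity, segmentParity, point, hle] at h₀ h₁ h₂
  grind

end Cut

end Tripods

theorem ncard_le_two_add {α : Type*} {W K P Q : Set α} (hK : K.Finite) (hP : P.Subsingleton)
    (hQ : Q.Subsingleton) (h : W ⊆ K ∪ P ∪ Q) : W.ncard ≤ 2 + K.ncard := by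
  have h₁ := Set.ncard_le_ncard h ((hK.union hP.finite).union hQ.finite)
  have h₂ := Set.ncard_union_le (K ∪ P) Q
  have h₃ := Set.ncard_union_le K P
  have h₄ := (Set.ncard_le_one hP.finite).2 fun _ ha _ hb => hP ha hb
  have h₅ := (Set.ncard_le_one hQ.finite).2 fun _ ha _ hb => hQ ha hb
  omega

theorem subsingleton_clusters_covering {ω : ℤ → ℤ × ℤ} {X : Set ℤ} {n : ℤ} (hX : X ⊆ Set.Icc 1 n)
    (t : ∀ x : X, Tripod ω x) (b : Bool) :
    {c | ∃ x : X, c = cluster ω ((t x).z b) ∧ (t x).z b < 1 ∧ n < (t x).y b}.Subsingleton := by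
  rintro _ ⟨x, rfl, hz, hy⟩ _ ⟨x', rfl, hz', hy'⟩
  have hx := hX x.2
  have hx' := hX x'.2
  rw [Set.mem_Icc] at hx hx'
  have h₁ := (t x).innermost b _ _ ((t x').matched b) (by omega) (by omega) ((t x').infinite_arc b)
  have h₂ := (t x').innermost b _ _ ((t x).matched b) (by omega) (by omega) ((t x).infinite_arc b)
  rw [le_antisymm h₁.1 h₂.1]

theorem Tripod.cluster_mem_or_covering {ω : ℤ → ℤ × ℤ} {x n : ℤ} (hx : x ∈ Set.Icc 1 n)
    (t : Tripod ω x) (b : Bool) :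
    cluster ω (t.z b) ∈ {c : (matchingGraph ω).ConnectedComponent |
      c.supp.Infinite ∧ (c.supp ∩ Set.Icc 1 n).Nonempty} ∨ (t.z b < 1 ∧ n < t.y b) := by
  rw [Set.mem_Icc] at hx
  have hlt := t.lt b
  have hgt := t.gt b
  rcases lt_or_ge (t.z b) 1 with hz | hz
  · rcases lt_or_ge n (t.y b) with hy | hy
    · exact Or.inr ⟨hz, hy⟩
    · refine Or.inl ⟨t.infinite_arc b, t.y b, ?_, by omega, hy⟩
      exact mem_supp_cluster.2 (MatchedSym.cluster_eq (Or.inl (t.matched b))).symm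
  · exact Or.inl ⟨t.infinite_arc b, t.z b, mem_supp_cluster.2 rfl, hz, by omega⟩

/-- for any `N`, the number of trifurcation points in `⟦1,N⟧` is at most
`2` plus the number of infinite components of `G` meeting `⟦1,N⟧`. -/
theorem trifurcations_le_infinite_clusters
    (ω : ℤ → ℤ × ℤ)
    (hω : ∀ x : ℤ, ((ω x).1 = 1 ∨ (ω x).1 = -1) ∧ ((ω x).2 = 1 ∨ (ω x).2 = -1))
    (N : ℕ) :
    (Tri ω ∩ Set.Icc (1 : ℤ) N).ncard
      ≤ 2 + {c : (matchingGraph ω).ConnectedComponent |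
              c.supp.Infinite ∧ (c.supp ∩ Set.Icc (1 : ℤ) N).Nonempty}.ncard := by
  classical
  have hε : ∀ b z, par ω b z = 1 ∨ par ω b z = -1 := by
    rintro (_ | _) z
    · exact (hω z).2
    · exact (hω z).1
  set K := {c : (matchingGraph ω).ConnectedComponent |
    c.supp.Infinite ∧ (c.supp ∩ Set.Icc (1 : ℤ) N).Nonempty} with hK
  set X := Tri ω ∩ Set.Icc (1 : ℤ) N with hX
  have hXsub : X ⊆ Set.Icc (1 : ℤ) N := Set.inter_subset_right
  have : Finite X := ((Set.finite_Icc _ _).subset hXsub).to_subtype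
  have : Fintype X := Fintype.ofFinite X
  have hKfin : K.Finite := by
    refine ((Set.finite_Icc (1 : ℤ) N).image (cluster ω)).subset ?_
    rintro c ⟨-, v, hv, hvN⟩
    exact ⟨v, hvN, (SimpleGraph.ConnectedComponent.mem_supp_iff _ _).1 hv⟩
  rcases isEmpty_or_nonempty X with hempty | hne
  · rw [Set.isEmpty_coe_sort.1 hempty, Set.ncard_empty]
    exact Nat.zero_le _
  have t : ∀ x : X, Cut ω x := fun x => (nonempty_cut hε x.2.1).some
  let W : Finset (matchingGraph ω).ConnectedComponent :=
    (Finset.univ : Finset (X × Fin 3)).image fun a => cluster ω ((t a.1).point a.2)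
  have hinf : ∀ x j, (cluster ω ((t x).point j)).supp.Infinite := by
    intro x j
    fin_cases j
    exacts [(t x).infinite, (t x).infinite_arc true, (t x).infinite_arc false]
  have hW : (W : Set (matchingGraph ω).ConnectedComponent).ncard ≤ 2 + K.ncard := by
    refine ncard_le_two_add hKfin
      (subsingleton_clusters_covering hXsub (fun x => (t x).toTripod) true)
      (subsingleton_clusters_covering hXsub (fun x => (t x).toTripod) false) ?_
    intro c hc
    obtain ⟨⟨x, j⟩, -, rfl⟩ := Finset.mem_image.1 (Finset.mem_coe.1 hc)
    fin_cases j
    · exact Or.inl (Or.inl ⟨(t x).infinite, x, mem_supp_cluster.2 rfl, hXsub x.2⟩)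
    · rcases (t x).cluster_mem_or_covering (hXsub x.2) true with h | h
      · exact Or.inl (Or.inl h)
      · exact Or.inl (Or.inr ⟨x, rfl, h⟩)
    · rcases (t x).cluster_mem_or_covering (hXsub x.2) false with h | h
      · exact Or.inl (Or.inl h)
      · exact Or.inr ⟨x, rfl, h⟩
  have hout : ∀ c : (matchingGraph ω).ConnectedComponent, cluster ω c.out = c := Quot.out_eq
  have hinj : ∀ x, Function.Injective fun j => cluster ω ((t x).point j) := by
    intro x j k hjk
    have h₁ := (t x).ne_self true
    have h₂ := (t x).ne_self false
    have h₃ := (t x).ne_other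
    fin_cases j <;> fin_cases k <;> first | rfl | exact absurd hjk ‹_› | exact absurd hjk.symm ‹_›
  have hside : ∀ x i k, (∀ l, l ≠ i → cluster ω k ≠ cluster ω ((t x).point l)) →
      (cluster ω k).supp.Infinite → (t x).side i (cluster ω k).out = (t x).side i k :=
    fun x i k hk hki => ((t x).side_eq_of_cluster_eq hε hki hk (hout _).symm).symm
  have hcount := card_triples_add_two_le (fun x j => cluster ω ((t x).point j))
    (fun x i x' => (t x).sideTripod i (t x') ≠ (t x).side i ((t x).point i))
    (fun x i c => (t x).side i c.out ≠ (t x).side i ((t x).point i)) hinj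
    (fun x i => not_not.2 (hside x i _ (fun l hl h => hl (hinj x h).symm) (hinf x i)))
    (fun x i x' j hx hj => by
      rw [hside x i _ hj (hinf x' j),
        (t x).side_point hε (t x') (fun h => hx (Subtype.ext h)) hj])
    (fun x x' _ => (t x).exists_sideTripod_ne hε (t x'))
    Finset.univ Finset.univ_nonempty W
    (fun x _ j => Finset.mem_image.2 ⟨(x, j), Finset.mem_univ _, rfl⟩)
  rw [Set.ncard_coe_finset] at hW
  rw [Finset.card_univ, ← Nat.card_eq_fintype_card, Nat.card_coe_set_eq] at hcount
  omega
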